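/- arXiv:2108.08276 — 2 statements merged into one kernel-verified Lean document; each statement's English description precedes it below -/
import Mathlib

section
/- Let X be a θ-↑↓-closed topologized semilattice such that cl_θ(C) is an H-set for every chain C ⊆ X. Then X is θ-complete. -/
open Set

/-- The θ-closure of a set in a topological space. -/
def thetaCl {X : Type*} [TopologicalSpace X] (A : Set X) : Set X :=
  {x | ∀ U : Set X, IsOpen U → x ∈ U → (closure U ∩ A).Nonempty}

/-- A subset `M` of a topological space is an H-set if every cover of `M` by open sets
contains a finite subfamily whose closures cover `M`. -/
def IsHSet {X : Type*} [TopologicalSpace X] (M : Set X) : Prop :=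
  ∀ 𝒰 : Set (Set X), (∀ U ∈ 𝒰, IsOpen U) → M ⊆ ⋃₀ 𝒰 →
    ∃ ℱ ⊆ 𝒰, ℱ.Finite ∧ M ⊆ ⋃ U ∈ ℱ, closure U

theorem theta_key {X : Type*} [TopologicalSpace X] (r : X → X → Prop)
    (hr : ∀ x, r x x) (ht : ∀ x y z, r x y → r y z → r x z) (C : Set X) (hne : C.Nonempty)
    (htot : ∀ x ∈ C, ∀ y ∈ C, r x y ∨ r y x) (hH : IsHSet (thetaCl C)) :
    ∃ x ∈ thetaCl C, ∀ c ∈ C, x ∈ thetaCl {y | r c y} := by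
  by_contra hcon
  push Not at hcon
  obtain ⟨F, hF, hfin, hcov⟩ := hH
    {U | IsOpen U ∧ ∃ c ∈ C, ∀ y ∈ closure U, ¬ r c y} (fun U hU => hU.1) (by
      intro x hx
      obtain ⟨c, hc, hxc⟩ := hcon x hx
      simp only [thetaCl, mem_setOf_eq, not_forall] at hxc
      obtain ⟨U, hU, hxU, hn⟩ := hxc
      exact ⟨U, ⟨hU, c, hc, fun y hy hcy => hn ⟨y, hy, hcy⟩⟩, hxU⟩)
  have hmax : ∃ c ∈ C, ∀ U ∈ F, ∀ y ∈ closure U, ¬ r c y := by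
    clear hcov
    induction F, hfin using Set.Finite.induction_on with
    | empty => exact ⟨hne.some, hne.some_mem, fun U hU => hU.elim⟩
    | @insert V S _ _ ih =>
      obtain ⟨c, hc, h⟩ := ih (fun U hU => hF (mem_insert_of_mem _ hU))
      obtain ⟨-, d, hd, h'⟩ := hF (mem_insert V S)
      rcases htot c hc d hd with hcd | hdc
      · refine ⟨d, hd, fun U hU y hy hdy => ?_⟩
        rcases hU with rfl | hU
        · exact h' y hy hdy
        · exact h U hU y hy (ht _ _ _ hcd hdy)
      · refine ⟨c, hc, fun U hU y hy hcy => ?_⟩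
        rcases hU with rfl | hU
        · exact h' y hy (ht _ _ _ hdc hcy)
        · exact h U hU y hy hcy
  obtain ⟨c, hc, h⟩ := hmax
  have hcm : c ∈ thetaCl C := fun U _ hcU => ⟨c, subset_closure hcU, hc⟩
  have := hcov hcm
  simp only [mem_iUnion] at this
  obtain ⟨U, hU, hcU⟩ := this
  exact h U hU c hcU (hr c)

theorem thetaCl_mono' {X : Type*} [TopologicalSpace X] {A B : Set X} (h : A ⊆ B) :
    thetaCl A ⊆ thetaCl B :=
  fun _ hx U hU hxU => (hx U hU hxU).mono (inter_subset_inter_right _ h)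

/-- A θ-↑↓-closed topologized semilattice in which `thetaCl C` is an
H-set for every chain `C` is θ-complete. -/
theorem theta_complete_of_HSet {X : Type*} [SemilatticeInf X] [TopologicalSpace X]
    (hud : ∀ x : X, thetaCl {y : X | x ≤ y} = {y : X | x ≤ y} ∧
      thetaCl {y : X | y ≤ x} = {y : X | y ≤ x})
    (hH : ∀ C : Set X, IsChain (· ≤ ·) C → IsHSet (thetaCl C)) :
    ∀ C : Set X, C.Nonempty → IsChain (· ≤ ·) C →
      ∃ a b : X, IsGLB C a ∧ IsLUB C b ∧ a ∈ thetaCl C ∧ b ∈ thetaCl C := by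
  intro C hne hC
  obtain ⟨b, hb, hb'⟩ := theta_key (fun x y : X => x ≤ y) (fun _ => le_rfl)
    (fun _ _ _ => le_trans) C hne (fun x hx y hy => hC.total hx hy) (hH C hC)
  obtain ⟨a, ha, ha'⟩ := theta_key (fun x y : X => y ≤ x) (fun _ => le_rfl)
    (fun _ _ _ h h' => le_trans h' h) C hne (fun x hx y hy => hC.total hy hx) (hH C hC)
  refine ⟨a, b, ⟨?_, ?_⟩, ⟨?_, ?_⟩, ha, hb⟩
  · intro c hc
    have := ha' c hc
    rw [(hud c).2] at this
    exact this
  · intro z hz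
    have := thetaCl_mono' (B := {y | z ≤ y}) (fun y hy => hz hy) ha
    rw [(hud z).1] at this
    exact this
  · intro c hc
    have := hb' c hc
    rw [(hud c).1] at this
    exact this
  · intro z hz
    have := thetaCl_mono' (B := {y | y ≤ z}) (fun y hy => hz hy) hb
    rw [(hud z).2] at this
    exact this
end

section
/- A θ-↑↓-closed topologized semilattice X is θ-complete if and only if cl_θ(C) is an H-set for every chain C ⊆ X. -/
open Set

theorem subset_thetaCl' {X : Type*} [TopologicalSpace X] (A : Set X) : A ⊆ thetaCl A :=
  fun x hx _ _ hxU => ⟨x, subset_closure hxU, hx⟩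

theorem thetaCl_union' {X : Type*} [TopologicalSpace X] {A B : Set X} {x : X}
    (h : x ∈ thetaCl (A ∪ B)) : x ∈ thetaCl A ∨ x ∈ thetaCl B := by
  by_contra hc
  push Not at hc
  obtain ⟨h1, h2⟩ := hc
  simp only [thetaCl, mem_setOf_eq, not_forall] at h1 h2
  obtain ⟨U, hU, hxU, h1⟩ := h1
  obtain ⟨V, hV, hxV, h2⟩ := h2
  obtain ⟨y, hy, hAB⟩ := h (U ∩ V) (hU.inter hV) ⟨hxU, hxV⟩
  rcases hAB with hA | hB
  · exact h1 ⟨y, closure_mono inter_subset_left hy, hA⟩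
  · exact h2 ⟨y, closure_mono inter_subset_right hy, hB⟩

theorem thetaCl_split {X : Type*} [PartialOrder X] [TopologicalSpace X]
    (hu : ∀ x : X, thetaCl {y : X | x ≤ y} = {y : X | x ≤ y})
    (hd : ∀ x : X, thetaCl {y : X | y ≤ x} = {y : X | y ≤ x})
    {C : Set X} {a b x : X} (h : ∀ c ∈ C, c ≤ a ∨ b ≤ c) (hx : x ∈ thetaCl C) :
    x ≤ a ∨ b ≤ x := by
  have h1 : C ⊆ {y | y ≤ a} ∪ {y | b ≤ y} := fun c hc => h c hc
  have h2 := thetaCl_union' (thetaCl_mono' h1 hx)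
  rwa [hu, hd] at h2

theorem thetaCl_chain {X : Type*} [PartialOrder X] [TopologicalSpace X]
    (hu : ∀ x : X, thetaCl {y : X | x ≤ y} = {y : X | x ≤ y})
    (hd : ∀ x : X, thetaCl {y : X | y ≤ x} = {y : X | y ≤ x})
    {C : Set X} (hC : IsChain (· ≤ ·) C) {x y : X} (hx : x ∈ thetaCl C) (hy : y ∈ thetaCl C) :
    x ≤ y ∨ y ≤ x := by
  refine thetaCl_split hu hd (fun c hc => ?_) hx
  refine (thetaCl_split hu hd (a := c) (b := c) (fun d hcd => ?_) hy).symm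
  exact hC.total hcd hc

theorem thetaCl_sup {X : Type*} [PartialOrder X] [TopologicalSpace X]
    (hu : ∀ x : X, thetaCl {y : X | x ≤ y} = {y : X | x ≤ y})
    (hd : ∀ x : X, thetaCl {y : X | y ≤ x} = {y : X | y ≤ x})
    (H : ∀ C : Set X, C.Nonempty → IsChain (· ≤ ·) C → ∃ b : X, IsLUB C b ∧ b ∈ thetaCl C)
    {C : Set X} (hC : IsChain (· ≤ ·) C) {D : Set X} (hD : D ⊆ thetaCl C) (hne : D.Nonempty) :
    ∃ b, IsLUB D b ∧ b ∈ thetaCl C ∧ b ∈ thetaCl D := by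
  have hDc : IsChain (· ≤ ·) D := fun x hx y hy _ => thetaCl_chain hu hd hC (hD hx) (hD hy)
  obtain ⟨b, hb, hbD⟩ := H D hne hDc
  refine ⟨b, hb, ?_, hbD⟩
  by_cases hbm : b ∈ D
  · exact hD hbm
  have hlt : ∀ d ∈ D, ∃ d' ∈ D, d < d' := by
    intro d hdD
    by_contra hc
    push Not at hc
    have : IsLUB D d := by
      refine ⟨fun e he => ?_, fun u hu => hu hdD⟩
      rcases hDc.total he hdD with h | h
      · exact h
      · rcases h.eq_or_lt with h | h
        · exact h.ge
        · exact absurd h (hc e he)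
    exact hbm (hb.unique this ▸ hdD)
  have key : ∀ d ∈ D, ∃ c ∈ C, d ≤ c ∧ ∃ e ∈ D, c ≤ e := by
    intro d hdD
    obtain ⟨d', hd', h1⟩ := hlt d hdD
    obtain ⟨e, he, h2⟩ := hlt d' hd'
    by_contra hc
    push Not at hc
    have := thetaCl_split hu hd (C := C) (a := d) (b := e) (x := d') (fun c hcC => ?_) (hD hd')
    · rcases this with h | h
      · exact absurd h h1.not_ge
      · exact absurd h h2.not_ge
    · rcases thetaCl_chain hu hd hC (subset_thetaCl' C hcC) (hD hdD) with h | h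
      · exact Or.inl h
      · right
        rcases thetaCl_chain hu hd hC (subset_thetaCl' C hcC) (hD he) with h' | h'
        · exact absurd h' (hc c hcC h e he)
        · exact h'
  let E : Set X := {c ∈ C | ∃ e ∈ D, c ≤ e}
  have hEne : E.Nonempty := by
    obtain ⟨d, hdD⟩ := hne
    obtain ⟨c, hc, _, h⟩ := key d hdD
    exact ⟨c, hc, h⟩
  obtain ⟨s, hs, hsE⟩ := H E hEne (hC.mono (fun _ h => h.1))
  have : IsLUB D s := by
    refine ⟨fun d hdD => ?_, fun u hu => hs.2 ?_⟩
    · obtain ⟨c, hc, h1, h⟩ := key d hdD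
      exact h1.trans (hs.1 ⟨hc, h⟩)
    · rintro c ⟨_, e, he, h⟩
      exact h.trans (hu he)
  rw [hb.unique this]
  exact thetaCl_mono' (fun _ h => h.1) hsE

theorem thetaCl_inf {X : Type*} [PartialOrder X] [TopologicalSpace X]
    (hu : ∀ x : X, thetaCl {y : X | x ≤ y} = {y : X | x ≤ y})
    (hd : ∀ x : X, thetaCl {y : X | y ≤ x} = {y : X | y ≤ x})
    (H : ∀ C : Set X, C.Nonempty → IsChain (· ≤ ·) C → ∃ b : X, IsGLB C b ∧ b ∈ thetaCl C)
    {C : Set X} (hC : IsChain (· ≤ ·) C) {D : Set X} (hD : D ⊆ thetaCl C) (hne : D.Nonempty) :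
    ∃ b, IsGLB D b ∧ b ∈ thetaCl C ∧ b ∈ thetaCl D :=
  thetaCl_sup (X := Xᵒᵈ) hd hu (fun C hne hC => H C hne hC.symm) (C := C) hC.symm (D := D) hD hne

theorem thetaCl_lub_of_HSet {X : Type*} [PartialOrder X] [TopologicalSpace X]
    (hu : ∀ x : X, thetaCl {y : X | x ≤ y} = {y : X | x ≤ y})
    (hd : ∀ x : X, thetaCl {y : X | y ≤ x} = {y : X | y ≤ x})
    {C : Set X} (hne : C.Nonempty) (hC : IsChain (· ≤ ·) C) (H : IsHSet (thetaCl C)) :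
    ∃ b : X, IsLUB C b ∧ b ∈ thetaCl C := by
  have key : ∃ b, ∀ c ∈ C, b ∈ thetaCl {y ∈ C | c ≤ y} := by
    by_contra hc
    push Not at hc
    let 𝒰 : Set (Set X) := {U | IsOpen U ∧ ∃ c ∈ C, ∀ y ∈ C, c ≤ y → y ∉ closure U}
    obtain ⟨F, hF, hfin, hcov⟩ := H 𝒰 (fun U h => h.1) (by
      intro x _
      obtain ⟨c, hcC, h⟩ := hc x
      simp only [thetaCl, mem_setOf_eq, not_forall] at h
      obtain ⟨U, hU, hxU, h⟩ := h
      exact ⟨U, ⟨hU, c, hcC, fun y hy hcy hyU => h ⟨y, hyU, hy, hcy⟩⟩, hxU⟩)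
    have : ∃ m ∈ C, ∀ U ∈ F, m ∉ closure U := by
      have : ∃ m ∈ C, ∀ U ∈ F, ∀ y ∈ C, m ≤ y → y ∉ closure U := by
        clear hcov
        induction F, hfin using Set.Finite.induction_on with
        | empty => exact ⟨hne.some, hne.some_mem, by simp⟩
        | @insert U F _ _ ih =>
          obtain ⟨m, hm, h⟩ := ih ((subset_insert _ _).trans hF)
          obtain ⟨_, c, hcC, h'⟩ := hF (mem_insert _ _)
          rcases hC.total hm hcC with hl | hl
          · refine ⟨c, hcC, ?_⟩
            rintro V (rfl | hV) y hy hle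
            · exact h' y hy hle
            · exact h V hV y hy (hl.trans hle)
          · refine ⟨m, hm, ?_⟩
            rintro V (rfl | hV) y hy hle
            · exact h' y hy (hl.trans hle)
            · exact h V hV y hy hle
      obtain ⟨m, hm, h⟩ := this
      exact ⟨m, hm, fun U hU => h U hU m hm le_rfl⟩
    obtain ⟨m, hm, h⟩ := this
    obtain ⟨U, hU, hmU⟩ := mem_iUnion₂.1 (hcov (subset_thetaCl' C hm))
    exact h U hU hmU
  obtain ⟨b, hb⟩ := key
  have hbC : b ∈ thetaCl C := thetaCl_mono' (fun _ h => h.1) (hb _ hne.some_mem)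
  refine ⟨b, ⟨fun c hc => ?_, fun u hub => ?_⟩, hbC⟩
  · have := thetaCl_mono' (B := {y | c ≤ y}) (fun _ h => h.2) (hb c hc)
    rwa [hu] at this
  · have := thetaCl_mono' (B := {y | y ≤ u}) (fun _ h => hub h) hbC
    rwa [hd] at this

theorem HSet_of_complete {X : Type*} [PartialOrder X] [TopologicalSpace X]
    (hu : ∀ x : X, thetaCl {y : X | x ≤ y} = {y : X | x ≤ y})
    (hd : ∀ x : X, thetaCl {y : X | y ≤ x} = {y : X | y ≤ x})
    (H : ∀ C : Set X, C.Nonempty → IsChain (· ≤ ·) C → ∃ b : X, IsLUB C b ∧ b ∈ thetaCl C)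
    (H' : ∀ C : Set X, C.Nonempty → IsChain (· ≤ ·) C → ∃ b : X, IsGLB C b ∧ b ∈ thetaCl C)
    {C : Set X} (hC : IsChain (· ≤ ·) C) : IsHSet (thetaCl C) := by
  intro 𝒰 hop hcov
  have sup := fun (D : Set X) => thetaCl_sup hu hd H hC (D := D)
  have inf := fun (D : Set X) => thetaCl_inf hu hd H' hC (D := D)
  have tot := fun (x y : X) => thetaCl_chain hu hd hC (x := x) (y := y)
  generalize thetaCl C = M at *
  let P : Set X → Prop := fun S => ∃ F ⊆ 𝒰, F.Finite ∧ S ⊆ ⋃ U ∈ F, closure U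
  change P M
  have Pmono : ∀ S T, S ⊆ T → P T → P S := fun S T h ⟨F, h1, h2, h3⟩ => ⟨F, h1, h2, h.trans h3⟩
  have Pun : ∀ S T, P S → P T → P (S ∪ T) := by
    rintro S T ⟨F, h1, h2, h3⟩ ⟨G, g1, g2, g3⟩
    refine ⟨F ∪ G, union_subset h1 g1, h2.union g2, ?_⟩
    rw [biUnion_union]
    exact union_subset_union h3 g3
  have PU : ∀ U ∈ 𝒰, P (closure U) := fun U hU =>
    ⟨{U}, by simpa using hU, finite_singleton _, by simp⟩
  have P1 : ∀ x ∈ M, P {x} := by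
    intro x hx
    obtain ⟨U, hU, hxU⟩ := hcov hx
    exact Pmono _ _ (by simpa using subset_closure hxU) (PU U hU)
  rcases M.eq_empty_or_nonempty with h0 | hne
  · exact ⟨∅, empty_subset _, finite_empty, by simp [h0]⟩
  obtain ⟨a, ha, haM, -⟩ := inf M subset_rfl hne
  let A : Set X := {x ∈ M | P {y ∈ M | y ≤ x}}
  have haA : a ∈ A := ⟨haM, Pmono _ _ (fun y hy => le_antisymm hy.2 (ha.1 hy.1)) (P1 a haM)⟩
  obtain ⟨s, hs, hsM, -⟩ := sup A (fun _ h => h.1) ⟨a, haA⟩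
  obtain ⟨U, hU, hsU⟩ := hcov hsM
  have hsA : P {y ∈ M | y ≤ s} := by
    have : ∃ t ∈ A, ∀ x ∈ M, x < s → x ∉ closure U → x ≤ t := by
      rcases Set.eq_empty_or_nonempty {x ∈ M | x < s ∧ x ∉ closure U} with h | h
      · refine ⟨a, haA, fun x h1 h2 h3 => ?_⟩
        have : x ∈ {x ∈ M | x < s ∧ x ∉ closure U} := ⟨h1, h2, h3⟩
        rw [h] at this
        exact this.elim
      · obtain ⟨d, hdl, hdM, hdD⟩ := sup _ (fun _ h => h.1) h
        have hds : d ≠ s := by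
          rintro rfl
          obtain ⟨y, h1, h2⟩ := hdD U (hop U hU) hsU
          exact h2.2.2 h1
        have hle : d ≤ s := hdl.2 (fun x hx => hx.2.1.le)
        by_contra hc
        push Not at hc
        refine hds (le_antisymm hle (hs.2 fun t ht => ?_))
        rcases tot t d ht.1 hdM with h | h
        · exact h
        · obtain ⟨x, h1, h2, h3, h4⟩ := hc t ht
          exact absurd ((hdl.1 ⟨h1, h2, h3⟩).trans h) h4
    obtain ⟨t, ht, h⟩ := this
    refine Pmono _ _ ?_ (Pun _ _ ht.2 (PU U hU))
    rintro x ⟨hx, hxs⟩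
    by_cases hxU : x ∈ closure U
    · exact Or.inr hxU
    · refine Or.inl ⟨hx, h x hx (lt_of_le_of_ne hxs ?_) hxU⟩
      rintro rfl
      exact hxU (subset_closure hsU)
  rcases Set.eq_empty_or_nonempty {x ∈ M | s < x ∧ x ∉ closure U} with h | h
  · refine Pmono _ _ ?_ (Pun _ _ hsA (PU U hU))
    intro x hx
    by_cases hxU : x ∈ closure U
    · exact Or.inr hxU
    · refine Or.inl ⟨hx, ?_⟩
      rcases tot x s hx hsM with h' | h'
      · exact h'
      rcases h'.eq_or_lt with h' | h'
      · exact h'.ge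
      have : x ∈ {x ∈ M | s < x ∧ x ∉ closure U} := ⟨hx, h', hxU⟩
      rw [h] at this
      exact this.elim
  · exfalso
    obtain ⟨e, hel, heM, heD⟩ := inf _ (fun _ h => h.1) h
    have hes : e ≠ s := by
      rintro rfl
      obtain ⟨y, h1, h2⟩ := heD U (hop U hU) hsU
      exact h2.2.2 h1
    have hle : s ≤ e := hel.2 (fun x hx => hx.2.1.le)
    have heA : e ∈ A := by
      refine ⟨heM, Pmono _ _ ?_ (Pun _ _ (Pun _ _ hsA (PU U hU)) (P1 e heM))⟩
      rintro x ⟨hx, hxe⟩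
      by_cases hxU : x ∈ closure U
      · exact Or.inl (Or.inr hxU)
      rcases tot x s hx hsM with h' | h'
      · exact Or.inl (Or.inl ⟨hx, h'⟩)
      rcases h'.eq_or_lt with h' | h'
      · exact Or.inl (Or.inl ⟨hx, h'.ge⟩)
      · exact Or.inr (le_antisymm hxe (hel.1 ⟨hx, h', hxU⟩))
    exact hes (le_antisymm (hs.1 heA) hle)

/-- A θ-↑↓-closed topologized semilattice is θ-complete iff `thetaCl C`
is an H-set for every chain `C`. -/
theorem theta_complete_iff_HSet {X : Type*} [SemilatticeInf X] [TopologicalSpace X]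
    (hud : ∀ x : X, thetaCl {y : X | x ≤ y} = {y : X | x ≤ y} ∧
      thetaCl {y : X | y ≤ x} = {y : X | y ≤ x}) :
    (∀ C : Set X, C.Nonempty → IsChain (· ≤ ·) C →
      ∃ a b : X, IsGLB C a ∧ IsLUB C b ∧ a ∈ thetaCl C ∧ b ∈ thetaCl C) ↔
    (∀ C : Set X, IsChain (· ≤ ·) C → IsHSet (thetaCl C)) := by
  have hu := fun x => (hud x).1
  have hd := fun x => (hud x).2
  constructor
  · intro H C hC
    refine HSet_of_complete hu hd (fun C h h' => ?_) (fun C h h' => ?_) hC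
    · obtain ⟨a, b, h1, h2, h3, h4⟩ := H C h h'
      exact ⟨b, h2, h4⟩
    · obtain ⟨a, b, h1, h2, h3, h4⟩ := H C h h'
      exact ⟨a, h1, h3⟩
  · intro H C hne hC
    obtain ⟨b, hb, hb'⟩ := thetaCl_lub_of_HSet hu hd hne hC (H C hC)
    obtain ⟨a, ha, ha'⟩ := thetaCl_lub_of_HSet (X := Xᵒᵈ) hd hu (C := C) hne hC.symm (H C hC)
    exact ⟨a, b, ha, hb, ha', hb'⟩
end
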